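/- Let p, q ≥ 2 be integers and n = p + q. Writing the chromatic polynomial of K_{p,q} as π(K_{p,q},x) = Σ_{i=1}^{n} (−1)^{n−i} h_i x^i, one has h_{n−3} = C(pq, 3) − C(p, 2)·C(q, 2); equivalently, the coefficient of x^{n−3} in π(K_{p,q},x) equals −(C(pq,3) − C(p,2)C(q,2)). -/

import Mathlib

open Polynomial

/-- `P` is the chromatic polynomial of `G`: for every natural number `k`,
`P` evaluated at `k` equals the number of proper colorings of `G` with `k` colors. -/
def IsChromaticPoly {V : Type*} (G : SimpleGraph V) (P : Polynomial ℂ) : Prop :=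
  ∀ k : ℕ, P.eval (k : ℂ) = Nat.card (G.Coloring (Fin k))

/-- The polynomial in `y = 1 / k` which, multiplied by `k ^ (p + q)`, counts the `k`-colorings of
`K_{p,q}` in which the part of size `q` additionally avoids `j` prescribed colors. -/
noncomputable def scaledColoringPoly (q : ℕ) : ℕ → ℕ → Polynomial ℂ
  | 0, j => (1 - C (j : ℂ) * X) ^ q
  | p + 1, j => C (j : ℂ) * X * scaledColoringPoly q p j
      + (1 - C (j : ℂ) * X) * scaledColoringPoly q p (j + 1)

theorem cast_choose_three (n : ℕ) :
    (n.choose 3 : ℂ) = n * (n - 1) * (n - 2) / 6 := by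
  induction n with
  | zero => simp
  | succ n ih =>
    rw [Nat.choose_succ_succ' n 2, Nat.cast_add, ih, Nat.cast_choose_two]
    push_cast
    ring

theorem coeff_succ_one_sub_C_mul_X_mul (a : ℂ) (R : Polynomial ℂ) (i : ℕ) :
    ((1 - C a * X) * R).coeff (i + 1) = R.coeff (i + 1) - a * R.coeff i := by
  rw [sub_mul, one_mul, coeff_sub, mul_assoc, coeff_C_mul, coeff_X_mul]

theorem coeff_one_sub_C_mul_X_pow (a : ℂ) (q : ℕ) :
    ((1 - C a * X) ^ q).coeff 0 = 1 ∧
    ((1 - C a * X) ^ q).coeff 1 = -(q * a) ∧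
    ((1 - C a * X) ^ q).coeff 2 = q * (q - 1) / 2 * a ^ 2 ∧
    ((1 - C a * X) ^ q).coeff 3 = -(q * (q - 1) * (q - 2) / 6 * a ^ 3) := by
  induction q with
  | zero => simp [coeff_one]
  | succ q ih =>
    obtain ⟨h0, h1, h2, h3⟩ := ih
    rw [pow_succ', coeff_succ_one_sub_C_mul_X_mul, coeff_succ_one_sub_C_mul_X_mul,
      coeff_succ_one_sub_C_mul_X_mul, h0, h1, h2, h3, mul_coeff_zero, h0]
    refine ⟨by simp, ?_, ?_, ?_⟩ <;> push_cast <;> ring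

theorem coeff_succ_scaledColoringPoly_succ (q p j i : ℕ) :
    (scaledColoringPoly q (p + 1) j).coeff (i + 1) =
      (scaledColoringPoly q p (j + 1)).coeff (i + 1)
        - j * ((scaledColoringPoly q p (j + 1)).coeff i - (scaledColoringPoly q p j).coeff i) := by
  rw [scaledColoringPoly, coeff_add, coeff_succ_one_sub_C_mul_X_mul, mul_assoc, coeff_C_mul,
    coeff_X_mul]
  ring

theorem coeff_scaledColoringPoly (q p j : ℕ) :
    (scaledColoringPoly q p j).coeff 0 = 1 ∧
    (scaledColoringPoly q p j).coeff 1 = -(q * (p + j)) ∧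
    (scaledColoringPoly q p j).coeff 2 =
      q * (q - 1) / 2 * (p + j) ^ 2 + q * (p * j + p * (p - 1) / 2) ∧
    (scaledColoringPoly q p j).coeff 3 =
      -(q * (q - 1) * (q - 2) / 6 * (p + j) ^ 3
        + q * (q - 1) / 2 * (2 * (p + j) - 1) * (p * j + p * (p - 1) / 2)
        + q * (j * (p * (p - 1) / 2) + p * (p - 1) * (p - 2) / 6)) := by
  induction p generalizing j with
  | zero =>
    obtain ⟨h0, h1, h2, h3⟩ := coeff_one_sub_C_mul_X_pow (j : ℂ) q
    rw [scaledColoringPoly, h0, h1, h2, h3]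
    refine ⟨rfl, ?_, ?_, ?_⟩ <;> push_cast <;> ring
  | succ p ih =>
    obtain ⟨h0, h1, h2, h3⟩ := ih j
    obtain ⟨k0, k1, k2, k3⟩ := ih (j + 1)
    refine ⟨?_, ?_, ?_, ?_⟩
    · simp [scaledColoringPoly, mul_coeff_zero, k0]
    · rw [coeff_succ_scaledColoringPoly_succ, h0, k0, k1]
      push_cast
      ring
    · rw [coeff_succ_scaledColoringPoly_succ, h1, k1, k2]
      push_cast
      ring
    · rw [coeff_succ_scaledColoringPoly_succ, h2, k2, k3]
      push_cast
      ring

theorem sum_pow_card_compl_union_image (q k : ℕ) (hk : k ≠ 0) (p : ℕ) (J : Finset (Fin k)) :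
    ∑ f : Fin p → Fin k, (((J ∪ Finset.univ.image f)ᶜ.card : ℂ)) ^ q =
      (k : ℂ) ^ (p + q) * (scaledColoringPoly q p J.card).eval (k : ℂ)⁻¹ := by
  have hk' : (k : ℂ) ≠ 0 := Nat.cast_ne_zero.mpr hk
  have hcompl (J : Finset (Fin k)) : (Jᶜ.card : ℂ) = k - J.card := by
    rw [Finset.card_compl, Nat.cast_sub (Finset.card_le_univ J), Fintype.card_fin]
  induction p generalizing J with
  | zero =>
    have h : (k : ℂ) - J.card = k * (1 - J.card * (k : ℂ)⁻¹) := by field_simp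
    simp [scaledColoringPoly, hcompl, h, mul_pow]
  | succ p ih =>
    have hunion (c : Fin k) (f : Fin p → Fin k) :
        J ∪ Finset.univ.image (Fin.consEquiv (fun _ : Fin (p + 1) => Fin k) (c, f)) =
          insert c J ∪ Finset.univ.image f := by
      ext x
      simp only [Fin.consEquiv, Equiv.coe_fn_mk, Finset.mem_union, Finset.mem_image,
        Finset.mem_univ, true_and, Fin.exists_fin_succ, Fin.cons_zero, Fin.cons_succ,
        Finset.mem_insert, eq_comm (a := x)]
      tauto
    rw [← (Fin.consEquiv fun _ : Fin (p + 1) => Fin k).sum_comp, Fintype.sum_prod_type]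
    simp only [hunion, ih]
    rw [← Finset.sum_add_sum_compl J, Finset.sum_congr rfl fun c hc => by
        rw [Finset.insert_eq_of_mem hc],
      Finset.sum_congr (s₁ := Jᶜ) rfl fun c hc => by
        rw [Finset.card_insert_of_notMem (Finset.mem_compl.mp hc)]]
    simp only [Finset.sum_const, nsmul_eq_mul, hcompl, scaledColoringPoly, eval_add, eval_mul,
      eval_sub, eval_one, eval_C, eval_X]
    field_simp
    ring

/-- A coloring of a complete bipartite graph is a map on the left part together with a map on the
right part avoiding the colors used on the left. -/
def completeBipartiteColoringEquiv (α β γ : Type*) [Fintype α] [Fintype γ] [DecidableEq γ] :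
    (completeBipartiteGraph α β).Coloring γ ≃
      Σ f : α → γ, β → {c // c ∈ (Finset.univ.image f)ᶜ} where
  toFun c := ⟨fun a => c (Sum.inl a), fun b => ⟨c (Sum.inr b), by
    simp only [Finset.mem_compl, Finset.mem_image, Finset.mem_univ, true_and, not_exists]
    exact fun a => c.valid (by simp)⟩⟩
  invFun s := SimpleGraph.Coloring.mk (Sum.elim s.1 fun b => (s.2 b).1) (by
    have h (a : α) (b : β) : s.1 a ≠ (s.2 b).1 := by
      have := (s.2 b).2
      simp only [Finset.mem_compl, Finset.mem_image, Finset.mem_univ, true_and, not_exists] at this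
      exact this a
    rintro (a | b) (a' | b') hab
    · simp at hab
    · exact h a b'
    · exact (h a' b).symm
    · simp at hab)
  left_inv c := by
    ext (a | b) <;> rfl
  right_inv s := rfl

theorem card_coloring_completeBipartiteGraph (p q k : ℕ) (hk : k ≠ 0) :
    (Nat.card ((completeBipartiteGraph (Fin p) (Fin q)).Coloring (Fin k)) : ℂ) =
      (k : ℂ) ^ (p + q) * (scaledColoringPoly q p 0).eval (k : ℂ)⁻¹ := by
  rw [Nat.card_congr (completeBipartiteColoringEquiv _ _ _), Nat.card_eq_fintype_card,
    Fintype.card_sigma]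
  simp only [Fintype.card_fun, Fintype.card_coe, Fintype.card_fin, Nat.cast_sum, Nat.cast_pow]
  simpa using sum_pow_card_compl_union_image q k hk p ∅

theorem reflect_eq_scaledColoringPoly {p q : ℕ} {P : Polynomial ℂ}
    (hP : IsChromaticPoly (completeBipartiteGraph (Fin p) (Fin q)) P)
    (hdeg : P.natDegree ≤ p + q) :
    P.reflect (p + q) = scaledColoringPoly q p 0 := by
  refine eq_of_infinite_eval_eq _ _ ((Set.infinite_range_of_injective
    (f := fun k : ℕ => ((k + 1 : ℕ) : ℂ)⁻¹) fun a b hab => ?_).mono ?_)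
  · simpa using hab
  · rintro _ ⟨k, rfl⟩
    have hk : ((k + 1 : ℕ) : ℂ) ≠ 0 := Nat.cast_ne_zero.mpr k.succ_ne_zero
    let u := invertibleOfNonzero hk
    have h := eval₂_reflect_mul_pow (RingHom.id ℂ) ((k + 1 : ℕ) : ℂ) (p + q) P hdeg
    rw [invOf_eq_inv, eval₂_id, eval₂_id, hP,
      card_coloring_completeBipartiteGraph p q (k + 1) k.succ_ne_zero, mul_comm] at h
    exact mul_left_cancel₀ (pow_ne_zero _ hk) h

/-- Writing `π(K_{p,q}, x) = ∑_{i=1}^{n} (-1)^{n-i} h_i x^i` with `n = p + q` and `p, q ≥ 2`,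
one has `h_{n-3} = C(pq, 3) - C(p, 2) * C(q, 2)`; equivalently, the coefficient of `x^{n-3}`
in `π(K_{p,q}, x)` equals `-(C(pq, 3) - C(p, 2) * C(q, 2))`. -/
theorem completeBipartite_chromatic_coeff_sub_three (p q : ℕ) (hp : 2 ≤ p) (hq : 2 ≤ q)
    (n : ℕ) (hn : n = p + q)
    (P : Polynomial ℂ) (hP : IsChromaticPoly (completeBipartiteGraph (Fin p) (Fin q)) P)
    (h : ℕ → ℂ)
    (hh : P = ∑ i ∈ Finset.Icc 1 n, C ((-1 : ℂ) ^ (n - i)) * C (h i) * X ^ i) :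
    h (n - 3) = ((p * q).choose 3 : ℂ) - (p.choose 2 : ℂ) * (q.choose 2 : ℂ) ∧
      P.coeff (n - 3) = -(((p * q).choose 3 : ℂ) - (p.choose 2 : ℂ) * (q.choose 2 : ℂ)) := by
  have hdeg : P.natDegree ≤ n := by
    rw [hh]
    refine natDegree_sum_le_of_forall_le _ _ fun i hi => ?_
    rw [← C_mul]
    exact (natDegree_C_mul_X_pow_le _ _).trans (Finset.mem_Icc.mp hi).2
  have hcoeff : P.coeff (n - 3) = -h (n - 3) := by
    have hmem : n - 3 ∈ Finset.Icc 1 n := Finset.mem_Icc.mpr ⟨by omega, by omega⟩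
    have hsub : n - (n - 3) = 3 := by omega
    rw [hh, finsetSum_coeff, Finset.sum_eq_single_of_mem _ hmem]
    · rw [← C_mul, coeff_C_mul_X_pow, if_pos rfl, hsub]
      ring
    · intro i _ hi
      rw [← C_mul, coeff_C_mul_X_pow, if_neg hi.symm]
  have hmain : P.coeff (n - 3) =
      -(((p * q).choose 3 : ℂ) - (p.choose 2 : ℂ) * (q.choose 2 : ℂ)) := by
    have hreflect := congrArg (fun R => R.coeff 3)
      (reflect_eq_scaledColoringPoly hP (hn ▸ hdeg))
    simp only [coeff_reflect] at hreflect
    rw [revAt_le (by omega), ← hn, (coeff_scaledColoringPoly q p 0).2.2.2] at hreflect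
    rw [hreflect, cast_choose_three, Nat.cast_choose_two, Nat.cast_choose_two]
    push_cast
    ring
  exact ⟨neg_injective (hcoeff.symm.trans hmain), hmain⟩
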